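/- Let G be a finite connected simple graph and let H be a retract of G. Then c_aa(H) ≤ c_aa(G) and c_af(H) ≤ c_af(G). -/

import Mathlib

open SimpleGraph

/-- Some pursuer occupies the evader's vertex at some point of the play: either at a
state `(z t, s t)` (including the initial state and states after the evader's move), or
at the midpoint of a round, after the pursuers' move and before the evader's move. -/
def Captured {V : Type*} {k : ℕ} (z : ℕ → Fin k → V) (s : ℕ → V) : Prop :=
  ∃ t, ∃ i, z t i = s t ∨ z (t + 1) i = s t

/-- A strategy for `k` cops: initial positions, together with a move that may depend on
the entire history of the play, i.e. the list of all states
`(cop positions, robber position)` so far. -/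
structure CopStrategy (V : Type*) (k : ℕ) where
  init : Fin k → V
  move : List ((Fin k → V) × V) → Fin k → V

/-- The cop positions `c` follow the strategy `C` against robber positions `r`. -/
def FollowsCopStrategy {V : Type*} {k : ℕ} (C : CopStrategy V k)
    (c : ℕ → Fin k → V) (r : ℕ → V) : Prop :=
  c 0 = C.init ∧
  ∀ t, c (t + 1) = C.move ((List.range (t + 1)).map fun j => (c j, r j))

/-- All cops are active: in each round every cop moves to an adjacent vertex. -/
def ActiveCops {V : Type*} (G : SimpleGraph V) {k : ℕ} (c : ℕ → Fin k → V) : Prop :=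
  ∀ t, ∀ i, G.Adj (c t i) (c (t + 1) i)

/-- A flexible robber: in each round the robber either stays or moves to an adjacent
vertex. -/
def FlexibleRobber {V : Type*} (G : SimpleGraph V) (r : ℕ → V) : Prop :=
  ∀ t, r (t + 1) = r t ∨ G.Adj (r t) (r (t + 1))

/-- An active robber: in each round the robber moves to an adjacent vertex. -/
def ActiveRobber {V : Type*} (G : SimpleGraph V) (r : ℕ → V) : Prop :=
  ∀ t, G.Adj (r t) (r (t + 1))

/-- `k` active cops have a winning strategy against an active robber on `G`. -/
def CopsWinAA {V : Type*} (G : SimpleGraph V) (k : ℕ) : Prop :=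
  ∃ C : CopStrategy V k, ∀ c : ℕ → Fin k → V, ∀ r : ℕ → V,
    FollowsCopStrategy C c r → ActiveRobber G r →
    ActiveCops G c ∧ Captured c r

/-- `k` active cops have a winning strategy against a flexible robber on `G`. -/
def CopsWinAF {V : Type*} (G : SimpleGraph V) (k : ℕ) : Prop :=
  ∃ C : CopStrategy V k, ∀ c : ℕ → Fin k → V, ∀ r : ℕ → V,
    FollowsCopStrategy C c r → FlexibleRobber G r →
    ActiveCops G c ∧ Captured c r

/-- `c_aa(G)`: the minimum number of active cops that win against an active robber. -/
noncomputable def copNumberAA {V : Type*} (G : SimpleGraph V) : ℕ :=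
  sInf {k | CopsWinAA G k}

/-- `c_af(G)`: the minimum number of active cops that win against a flexible robber. -/
noncomputable def copNumberAF {V : Type*} (G : SimpleGraph V) : ℕ :=
  sInf {k | CopsWinAF G k}

/-- The cop positions prescribed by `C` after the history `L`. -/
def CopStrategy.next {V : Type*} {k : ℕ} (C : CopStrategy V k) :
    List ((Fin k → V) × V) → Fin k → V
  | [] => C.init
  | p :: L => C.move (p :: L)

/-- The history that arises when `C` is played against the listed robber positions. -/
def CopStrategy.history {V : Type*} {k : ℕ} (C : CopStrategy V k) (R : List V) :
    List ((Fin k → V) × V) :=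
  R.foldl (fun L v => L ++ [(C.next L, v)]) []

/-- The cop positions when `C` is played against the robber positions `r`. -/
def CopStrategy.play {V : Type*} {k : ℕ} (C : CopStrategy V k) (r : ℕ → V) (t : ℕ) :
    Fin k → V :=
  C.next (C.history ((List.range t).map r))

theorem CopStrategy.history_map_range {V : Type*} {k : ℕ} (C : CopStrategy V k)
    (r : ℕ → V) (t : ℕ) :
    C.history ((List.range t).map r) = (List.range t).map fun j => (C.play r j, r j) := by
  induction t with
  | zero => rfl
  | succ t ih =>
    rw [List.range_succ, List.map_append, List.map_append, ← ih]
    simp [CopStrategy.history, CopStrategy.play]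

theorem CopStrategy.play_follows {V : Type*} {k : ℕ} (C : CopStrategy V k) (r : ℕ → V) :
    FollowsCopStrategy C (C.play r) r := by
  refine ⟨rfl, fun t => ?_⟩
  rw [CopStrategy.play, CopStrategy.history_map_range, List.range_succ_eq_map]
  rfl

/-- A cop strategy on `V` induces one on `W`: robber positions are carried to `V` by `g`,
and the answers of the strategy are carried back by `f`. -/
def CopStrategy.transfer {V W : Type*} {k : ℕ} (C : CopStrategy V k) (f : V → W) (g : W → V) :
    CopStrategy W k where
  init i := f (C.init i)
  move L i := f (C.next (C.history (L.map fun p => g p.2)) i)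

theorem FollowsCopStrategy.eq_transfer_play {V W : Type*} {k : ℕ} {C : CopStrategy V k}
    {f : V → W} {g : W → V} {c : ℕ → Fin k → W} {r : ℕ → W}
    (h : FollowsCopStrategy (C.transfer f g) c r) (t : ℕ) (i : Fin k) :
    c t i = f (C.play (fun s => g (r s)) t i) := by
  cases t with
  | zero => rw [h.1]; rfl
  | succ t =>
    rw [h.2 t]
    simp only [CopStrategy.transfer, CopStrategy.play, List.map_map]
    rfl

theorem ActiveCops.and_captured_of_retraction {V W : Type*} {G : SimpleGraph V}
    {H : SimpleGraph W} {k : ℕ} {f : G →g H} {g : W → V} (hfg : ∀ w, f (g w) = w)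
    {c : ℕ → Fin k → V} {d : ℕ → Fin k → W} {r : ℕ → W}
    (hd : ∀ t i, d t i = f (c t i)) (ha : ActiveCops G c)
    (hc : Captured c fun t => g (r t)) : ActiveCops H d ∧ Captured d r := by
  refine ⟨fun t i => ?_, ?_⟩
  · rw [hd, hd]
    exact f.map_adj (ha t i)
  · obtain ⟨t, i, h⟩ := hc
    refine ⟨t, i, h.imp (fun h => ?_) fun h => ?_⟩ <;> rw [hd, h, hfg]

theorem CopsWinAA.of_retraction {V W : Type*} {G : SimpleGraph V} {H : SimpleGraph W} {k : ℕ}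
    (h : CopsWinAA G k) (f : G →g H) (g : H →g G) (hfg : ∀ w, f (g w) = w) :
    CopsWinAA H k := by
  obtain ⟨C, hC⟩ := h
  refine ⟨C.transfer f g, fun c r hc hr => ?_⟩
  obtain ⟨ha, hcap⟩ := hC _ _ (C.play_follows fun t => g (r t)) fun t => g.map_adj (hr t)
  exact ha.and_captured_of_retraction hfg hc.eq_transfer_play hcap

theorem CopsWinAF.of_retraction {V W : Type*} {G : SimpleGraph V} {H : SimpleGraph W} {k : ℕ}
    (h : CopsWinAF G k) (f : G →g H) (g : H →g G) (hfg : ∀ w, f (g w) = w) :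
    CopsWinAF H k := by
  obtain ⟨C, hC⟩ := h
  refine ⟨C.transfer f g, fun c r hc hr => ?_⟩
  obtain ⟨ha, hcap⟩ := hC _ _ (C.play_follows fun t => g (r t))
    fun t => (hr t).imp (congrArg g) g.map_adj
  exact ha.and_captured_of_retraction hfg hc.eq_transfer_play hcap

theorem CopsWinAF.copsWinAA {V : Type*} {G : SimpleGraph V} {k : ℕ} (h : CopsWinAF G k) :
    CopsWinAA G k := by
  obtain ⟨C, hC⟩ := h
  exact ⟨C, fun c r hc hr => hC c r hc fun t => Or.inr (hr t)⟩

/-- In a graph without isolated vertices, one cop on each vertex wins at once. -/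
theorem copsWinAF_card {V : Type*} [Fintype V] (G : SimpleGraph V)
    (hG : ∀ v, ∃ w, G.Adj v w) : CopsWinAF G (Fintype.card V) := by
  choose n hn using hG
  let e := Fintype.equivFin V
  refine ⟨⟨e.symm, fun L i => n ((L.getLast?.map fun p => p.1 i).getD (e.symm i))⟩,
    fun c r hc _ => ⟨fun t i => ?_, 0, e (r 0), Or.inl ?_⟩⟩
  · rw [hc.2 t]
    simpa [List.range_succ] using hn (c t i)
  · rw [hc.1]
    exact e.symm_apply_apply _

theorem copsWinAA_of_subsingleton {V : Type*} [Subsingleton V] [Nonempty V]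
    (G : SimpleGraph V) (k : ℕ) : CopsWinAA G k :=
  ⟨⟨fun _ => Classical.arbitrary V, fun _ _ => Classical.arbitrary V⟩, fun _ _ _ hr =>
    ((hr 0).ne (Subsingleton.elim _ _)).elim⟩

theorem not_copsWinAF_of_subsingleton {V : Type*} [Subsingleton V] [Nonempty V]
    (G : SimpleGraph V) (k : ℕ) : ¬ CopsWinAF G k := by
  rintro ⟨C, hC⟩
  obtain ⟨ha, t, i, -⟩ := hC _ _ (C.play_follows fun _ => Classical.arbitrary V)
    fun _ => Or.inl rfl
  exact (ha t i).ne (Subsingleton.elim _ _)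

/-- If `H` is a retract of a finite connected simple graph `G` (a subgraph of `G`
admitting a graph homomorphism `f : G → H` which is the identity on `H`), then
`c_aa(H) ≤ c_aa(G)` and `c_af(H) ≤ c_af(G)`. -/
theorem copNumber_retract_le {V : Type*} [Fintype V] (G : SimpleGraph V)
    (hG : G.Connected) (H : G.Subgraph) (f : G →g H.coe)
    (hf : ∀ v (hv : v ∈ H.verts), f v = ⟨v, hv⟩) :
    copNumberAA H.coe ≤ copNumberAA G ∧ copNumberAF H.coe ≤ copNumberAF G := by
  have hfg : ∀ w, f (H.hom w) = w := fun w => hf w w.2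
  have hAA (hne : {k | CopsWinAA G k}.Nonempty) : copNumberAA H.coe ≤ copNumberAA G :=
    Nat.sInf_le (CopsWinAA.of_retraction (Nat.sInf_mem hne) f H.hom hfg)
  have hAF (hne : {k | CopsWinAF G k}.Nonempty) : copNumberAF H.coe ≤ copNumberAF G :=
    Nat.sInf_le (CopsWinAF.of_retraction (Nat.sInf_mem hne) f H.hom hfg)
  have := hG.nonempty
  rcases subsingleton_or_nontrivial V with _ | _
  · have : Nonempty H.verts := this.map f
    exact ⟨hAA ⟨0, copsWinAA_of_subsingleton G 0⟩,
      by simp [copNumberAF, not_copsWinAF_of_subsingleton]⟩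
  · have hw := copsWinAF_card G fun v => hG.preconnected.exists_adj_of_nontrivial v
    exact ⟨hAA ⟨_, hw.copsWinAA⟩, hAF ⟨_, hw⟩⟩
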